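/- arXiv:2201.02450 — 3 statements merged into one kernel-verified Lean document; each statement's English description precedes it below -/
import Mathlib

section
/- Let n₁ = d² and let W_1, …, W_{d²} be positive definite density matrices on ℂ^d that are linearly independent over ℝ in the real vector space of Hermitian matrices. Let A_1, …, A_{d²−1} be linearly independent Hermitian d×d matrices with Tr(W_{d²} A_j) = 0 for every j, set h_{i,j} = Tr(W_i A_j), and for θ ∈ ℝ^{d²−1} define φ(θ) = log Tr exp(∑_{j=1}^{d²−1} θ^j A_j) and ρ_θ = exp(∑_{j=1}^{d²−1} θ^j A_j − φ(θ)·I). Suppose ∑_{j=1}^{d²−1} h_{i,j} θ^j = −H(W_i) + H(W_{d²}) for every i ∈ {1,…,d²}, and suppose there exists Q̂ : {1,…,d²} → ℝ with Q̂(x) ≥ 0 for all x and ∑_x Q̂(x) W_x = ρ_θ. Then φ(θ) − H(W_{d²}) = C_q(W). -/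
open Real Finset Matrix ComplexOrder

/-- Functional calculus for Hermitian matrices: apply `g : ℝ → ℝ` to the
eigenvalues (junk value `0` on non-Hermitian input). -/
noncomputable def hermCFC {d : ℕ} (g : ℝ → ℝ) (A : Matrix (Fin d) (Fin d) ℂ) :
    Matrix (Fin d) (Fin d) ℂ :=
  if hA : A.IsHermitian then hA.cfc g else 0

/-- Matrix logarithm via the functional calculus on Hermitian matrices. -/
noncomputable def mLog {d : ℕ} : Matrix (Fin d) (Fin d) ℂ → Matrix (Fin d) (Fin d) ℂ :=
  hermCFC Real.log

/-- Matrix exponential via the functional calculus on Hermitian matrices. -/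
noncomputable def mExp {d : ℕ} : Matrix (Fin d) (Fin d) ℂ → Matrix (Fin d) (Fin d) ℂ :=
  hermCFC Real.exp

/-- von Neumann entropy `H(ρ) = −Tr(ρ log ρ)`. -/
noncomputable def qEnt {d : ℕ} (ρ : Matrix (Fin d) (Fin d) ℂ) : ℝ :=
  (-((ρ * mLog ρ).trace)).re

/-- Quantum relative entropy `D(ρ‖σ) = Tr(ρ (log ρ − log σ))`. -/
noncomputable def qRel {d : ℕ} (ρ σ : Matrix (Fin d) (Fin d) ℂ) : ℝ :=
  ((ρ * (mLog ρ - mLog σ)).trace).re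

/-- `φ(θ) = log Tr exp(∑_j θ^j A_j)`. -/
noncomputable def qPhi {d k : ℕ} (A : Fin k → Matrix (Fin d) (Fin d) ℂ)
    (θ : Fin k → ℝ) : ℝ :=
  Real.log ((mExp (∑ j, θ j • A j)).trace.re)

/-- `ρ_θ = exp(∑_j θ^j A_j − φ(θ)·I)`. -/
noncomputable def qRho {d k : ℕ} (A : Fin k → Matrix (Fin d) (Fin d) ℂ)
    (θ : Fin k → ℝ) : Matrix (Fin d) (Fin d) ℂ :=
  mExp (∑ j, θ j • A j - qPhi A θ • (1 : Matrix (Fin d) (Fin d) ℂ))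

/-- The capacity of the classical–quantum channel `W`, i.e. the maximum over input
distributions `p` of `∑_x p x · D(W_x‖∑_{x'} p x' W_{x'})`. -/
noncomputable def qCapacity {n d : ℕ} (W : Fin n → Matrix (Fin d) (Fin d) ℂ) : ℝ :=
  sSup {c | ∃ p : Fin n → ℝ, (∀ x, 0 ≤ p x) ∧ (∑ x, p x = 1) ∧
    c = ∑ x, p x * qRel (W x) (∑ x', p x' • W x')}

lemma continuousOn_spectrum_real {d : ℕ} (A : Matrix (Fin d) (Fin d) ℂ) (g : ℝ → ℝ) :
    ContinuousOn g (spectrum ℝ A) :=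
  (Matrix.finite_real_spectrum (A := A)).continuousOn g

lemma hermCFC_eq_cfc {d : ℕ} (g : ℝ → ℝ) {A : Matrix (Fin d) (Fin d) ℂ} (hA : A.IsHermitian) :
    hermCFC g A = cfc g A := by
  rw [hermCFC, dif_pos hA, hA.cfc_eq]

lemma Matrix.IsHermitian.isHermitian_cfc {d : ℕ} (g : ℝ → ℝ) (A : Matrix (Fin d) (Fin d) ℂ) :
    (cfc g A).IsHermitian :=
  cfc_predicate g A

lemma mLog_mExp {d : ℕ} {K : Matrix (Fin d) (Fin d) ℂ} (hK : K.IsHermitian) :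
    mLog (mExp K) = K := by
  have hK' : IsSelfAdjoint K := hK
  rw [mExp, hermCFC_eq_cfc _ hK, mLog, hermCFC_eq_cfc _ (IsHermitian.isHermitian_cfc _ _),
    ← cfc_comp' Real.log Real.exp K (((Matrix.finite_real_spectrum (A := K)).image _).continuousOn _)
      (continuousOn_spectrum_real _ _) hK']
  simp only [Real.log_exp]
  exact cfc_id' ℝ K hK'

lemma mExp_sub_smul_one {d : ℕ} {H : Matrix (Fin d) (Fin d) ℂ} (hH : H.IsHermitian) (t : ℝ) :
    mExp (H - t • (1 : Matrix (Fin d) (Fin d) ℂ)) = Real.exp (-t) • mExp H := by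
  have hH' : IsSelfAdjoint H := hH
  have hc (g : ℝ → ℝ) : ContinuousOn g (spectrum ℝ H) := continuousOn_spectrum_real H g
  have h1 : H - t • (1 : Matrix (Fin d) (Fin d) ℂ) = cfc (fun x : ℝ ↦ x - t) H := by
    rw [cfc_sub (fun x : ℝ ↦ x) (fun _ ↦ t) (a := H) (hc _) (hc _), cfc_id' ℝ H hH',
      cfc_const t H hH', Algebra.algebraMap_eq_smul_one]
  rw [h1, mExp, hermCFC_eq_cfc _ (IsHermitian.isHermitian_cfc _ _), hermCFC_eq_cfc _ hH,
    ← cfc_comp' Real.exp _ H (((Matrix.finite_real_spectrum (A := H)).image _).continuousOn _)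
      (hc _) hH', ← cfc_smul _ _ _ (hc _)]
  congr 1
  ext x
  rw [smul_eq_mul, ← Real.exp_add]
  ring_nf

/-- The trace of a product of functions of two Hermitian matrices is a nonnegative combination
of the products of the function values at the eigenvalues. -/
lemma exists_trace_cfc_mul_cfc {d : ℕ} {A B : Matrix (Fin d) (Fin d) ℂ}
    (hA : A.IsHermitian) (hB : B.IsHermitian) :
    ∃ c : Fin d → Fin d → ℝ, (∀ i j, 0 ≤ c i j) ∧ ∀ f g : ℝ → ℝ,
      (cfc f A * cfc g B).trace =
        ((∑ i, ∑ j, f (hA.eigenvalues i) * g (hB.eigenvalues j) * c i j : ℝ) : ℂ) := by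
  set U : Matrix (Fin d) (Fin d) ℂ := (hA.eigenvectorUnitary).1
  set V : Matrix (Fin d) (Fin d) ℂ := (hB.eigenvectorUnitary).1
  refine ⟨fun i j ↦ Complex.normSq ((star U * V) i j), fun i j ↦ Complex.normSq_nonneg _,
    fun f g ↦ ?_⟩
  rw [hA.cfc_eq, hB.cfc_eq, IsHermitian.cfc, IsHermitian.cfc, Unitary.conjStarAlgAut_apply,
    Unitary.conjStarAlgAut_apply]
  have h : star V * U = star (star U * V) := by simp
  trans (diagonal (RCLike.ofReal ∘ f ∘ hA.eigenvalues) * (star U * V) *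
      (diagonal (RCLike.ofReal ∘ g ∘ hB.eigenvalues) * star (star U * V))).trace
  · rw [← h]
    simp only [U, V, Matrix.mul_assoc]
    rw [Matrix.trace_mul_comm]
    simp only [Matrix.mul_assoc]
  · simp only [Matrix.trace, Matrix.diag_apply, Matrix.mul_apply (M := diagonal _ * _),
      diagonal_mul, Matrix.star_apply, Function.comp_apply]
    push_cast
    refine Finset.sum_congr rfl fun i _ ↦ Finset.sum_congr rfl fun j _ ↦ ?_
    rw [Complex.normSq_eq_conj_mul_self]
    simp only [RCLike.star_def, Complex.coe_algebraMap]
    ring!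

lemma trace_mExp_re_pos {d : ℕ} (hd : 0 < d) {H : Matrix (Fin d) (Fin d) ℂ}
    (hH : H.IsHermitian) : 0 < (mExp H).trace.re := by
  have : Nonempty (Fin d) := ⟨⟨0, hd⟩⟩
  rw [mExp, hermCFC, dif_pos hH, IsHermitian.cfc, Unitary.conjStarAlgAut_apply,
    Matrix.trace_mul_comm, ← Matrix.mul_assoc, Unitary.coe_star_mul_self, Matrix.one_mul,
    Matrix.trace_diagonal, Complex.re_sum]
  exact Finset.sum_pos (fun i _ ↦ Real.exp_pos _) Finset.univ_nonempty

/-- Klein's inequality: the quantum relative entropy of states is nonnegative. -/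
lemma qRel_nonneg {d : ℕ} {σ ρ : Matrix (Fin d) (Fin d) ℂ} (hσ : σ.PosDef) (hρ : ρ.PosDef)
    (htr : σ.trace = ρ.trace) : 0 ≤ qRel σ ρ := by
  have hs := hσ.isHermitian
  have hr := hρ.isHermitian
  have hs' : IsSelfAdjoint σ := hs
  have hr' : IsSelfAdjoint ρ := hr
  obtain ⟨c, hc, h⟩ := exists_trace_cfc_mul_cfc hs hr
  have hlog : cfc (fun x : ℝ ↦ x * Real.log x) σ = σ * mLog σ := by
    rw [cfc_mul _ _ _ (continuousOn_spectrum_real _ _) (continuousOn_spectrum_real _ _),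
      cfc_id' ℝ σ hs', mLog, hermCFC_eq_cfc _ hs]
  have h1 := h (fun x ↦ x * Real.log x) (fun _ ↦ 1)
  have h2 := h (fun x ↦ x) Real.log
  have h3 := h (fun x ↦ x) (fun _ ↦ 1)
  have h4 := h (fun _ ↦ 1) (fun x ↦ x)
  rw [hlog, cfc_const_one ℝ ρ hr', mul_one] at h1
  rw [cfc_id' ℝ σ hs', ← hermCFC_eq_cfc _ hr] at h2
  rw [cfc_id' ℝ σ hs', cfc_const_one ℝ ρ hr', mul_one] at h3
  rw [cfc_id' ℝ ρ hr', cfc_const_one ℝ σ hs', one_mul, ← htr, h3, Complex.ofReal_inj] at h4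
  rw [qRel, mul_sub, trace_sub, h1, mLog, h2, Complex.sub_re, Complex.ofReal_re, Complex.ofReal_re,
    sub_nonneg, ← add_le_add_iff_right (∑ i, ∑ j, hs.eigenvalues i * 1 * c i j)]
  nth_rw 2 [h4]
  simp only [← Finset.sum_add_distrib]
  refine Finset.sum_le_sum fun i _ ↦ Finset.sum_le_sum fun j _ ↦ ?_
  have hsi := hσ.eigenvalues_pos i
  have hrj := hρ.eigenvalues_pos j
  have hl := Real.log_le_sub_one_of_pos (div_pos hrj hsi)
  rw [Real.log_div hrj.ne' hsi.ne'] at hl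
  have hm := mul_le_mul_of_nonneg_left hl hsi.le
  rw [mul_sub, mul_sub, mul_div_cancel₀ _ hsi.ne'] at hm
  have hn := mul_nonneg (hc i j) (sub_nonneg.2 hm)
  linarith

lemma posDef_sum_smul {n d : ℕ} {W : Fin n → Matrix (Fin d) (Fin d) ℂ} (hW : ∀ i, (W i).PosDef)
    {p : Fin n → ℝ} (hp : ∀ i, 0 ≤ p i) (hp1 : ∑ i, p i = 1) : (∑ i, p i • W i).PosDef := by
  obtain ⟨i, -, hi⟩ := Finset.exists_ne_zero_of_sum_ne_zero (hp1.trans_ne one_ne_zero)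
  rw [← Finset.add_sum_erase _ _ (Finset.mem_univ i)]
  exact ((hW i).smul ((hp i).lt_of_ne' hi)).add_posSemidef
    (posSemidef_sum _ fun j _ ↦ (hW j).posSemidef.smul (hp j))

lemma trace_sum_smul {n d : ℕ} {W : Fin n → Matrix (Fin d) (Fin d) ℂ} (hW : ∀ i, (W i).trace = 1)
    (p : Fin n → ℝ) : (∑ i, p i • W i).trace = ((∑ i, p i : ℝ) : ℂ) := by
  simp [trace_sum, trace_smul, hW]

/-- Donald's identity for the relative entropies from the members of an ensemble. -/
lemma sum_mul_qRel_sum {n d : ℕ} (W : Fin n → Matrix (Fin d) (Fin d) ℂ) (p : Fin n → ℝ)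
    (σ : Matrix (Fin d) (Fin d) ℂ) :
    ∑ x, p x * qRel (W x) (∑ x', p x' • W x') =
      ∑ x, p x * qRel (W x) σ - qRel (∑ x, p x • W x) σ := by
  have h (τ : Matrix (Fin d) (Fin d) ℂ) :
      ((∑ x, p x • W x) * τ).trace.re = ∑ x, p x * (W x * τ).trace.re := by
    simp [Finset.sum_mul, trace_sum, trace_smul]
  rw [qRel, h, ← Finset.sum_sub_distrib]
  refine Finset.sum_congr rfl fun x _ ↦ ?_
  simp only [qRel, mul_sub, trace_sub, Complex.sub_re]
  ring

lemma qCapacity_eq_of_qRel_eq {n d : ℕ} {W : Fin n → Matrix (Fin d) (Fin d) ℂ}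
    (hWpd : ∀ i, (W i).PosDef) (hWtr : ∀ i, (W i).trace = 1) {q : Fin n → ℝ}
    (hq : ∀ x, 0 ≤ q x) (hq1 : ∑ x, q x = 1) {C : ℝ}
    (hC : ∀ x, qRel (W x) (∑ x', q x' • W x') = C) : qCapacity W = C := by
  refine IsGreatest.csSup_eq ⟨⟨q, hq, hq1, ?_⟩, ?_⟩
  · simp [hC, ← Finset.sum_mul, hq1]
  · rintro _ ⟨p, hp, hp1, rfl⟩
    have hD := qRel_nonneg (posDef_sum_smul hWpd hp hp1) (posDef_sum_smul hWpd hq hq1)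
      (by rw [trace_sum_smul hWtr, trace_sum_smul hWtr, hp1, hq1])
    rw [sum_mul_qRel_sum W p (∑ x', q x' • W x')]
    simp only [hC, ← Finset.sum_mul, hp1, one_mul]
    linarith

/-- if `θ` solves the linear system and `ρ_θ` is a nonnegative mixture
of the `W_x`, then `φ(θ) − H(W_{d²}) = C_q(W)`. -/
theorem stmt7 {d : ℕ} (hd : 0 < d)
    (W : Fin (d ^ 2) → Matrix (Fin d) (Fin d) ℂ)
    (hWpd : ∀ i, (W i).PosDef) (hWtr : ∀ i, (W i).trace = 1)
    (hWli : LinearIndependent ℝ W)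
    (A : Fin (d ^ 2 - 1) → Matrix (Fin d) (Fin d) ℂ)
    (hAherm : ∀ j, (A j).IsHermitian) (hAli : LinearIndependent ℝ A)
    (hortho : ∀ j, (W ⟨d ^ 2 - 1, Nat.sub_lt (pow_pos hd 2) one_pos⟩ * A j).trace = 0)
    (θ : Fin (d ^ 2 - 1) → ℝ)
    (hθ : ∀ i, ∑ j, ((W i * A j).trace).re * θ j
        = -qEnt (W i) + qEnt (W ⟨d ^ 2 - 1, Nat.sub_lt (pow_pos hd 2) one_pos⟩))
    (Qhat : Fin (d ^ 2) → ℝ) (hQpos : ∀ x, 0 ≤ Qhat x)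
    (hQmix : ∑ x, Qhat x • W x = qRho A θ) :
    qPhi A θ - qEnt (W ⟨d ^ 2 - 1, Nat.sub_lt (pow_pos hd 2) one_pos⟩)
      = qCapacity W := by
  set w := W ⟨d ^ 2 - 1, Nat.sub_lt (pow_pos hd 2) one_pos⟩
  set H := ∑ j, θ j • A j with hHdef
  have hH : H.IsHermitian :=
    isSelfAdjoint_sum _ fun j _ ↦ IsSelfAdjoint.smul (star_trivial (θ j)) (hAherm j)
  have hK : (H - qPhi A θ • (1 : Matrix (Fin d) (Fin d) ℂ)).IsHermitian :=
    hH.sub (IsSelfAdjoint.smul (star_trivial (qPhi A θ)) isHermitian_one)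
  have hQ1 : ∑ x, Qhat x = 1 := by
    have ht := congrArg (fun M ↦ M.trace.re) hQmix
    have hpos := trace_mExp_re_pos hd hH
    simp only [trace_sum_smul hWtr, Complex.ofReal_re, qRho] at ht
    rw [ht, mExp_sub_smul_one hH, trace_smul, Complex.smul_re, qPhi, Real.exp_neg,
      Real.exp_log hpos, smul_eq_mul, inv_mul_cancel₀ hpos.ne']
  refine (qCapacity_eq_of_qRel_eq hWpd hWtr hQpos hQ1 fun x ↦ ?_).symm
  have hx := hθ x
  have hWH : (W x * H).trace.re = ∑ j, ((W x * A j).trace).re * θ j := by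
    simp [hHdef, Finset.mul_sum, trace_sum, trace_smul, mul_comm]
  have hqE : qEnt (W x) = -(W x * mLog (W x)).trace.re := by simp [qEnt]
  rw [hQmix, qRel, qRho, mLog_mExp hK, mul_sub, mul_sub, trace_sub, trace_sub, Complex.sub_re,
    Complex.sub_re, hWH, hx, mul_smul_comm, mul_one, trace_smul, hWtr, hqE, Complex.smul_re]
  simp
  ring
end

section
/- Let P be a full-support probability distribution on a finite set Z, let f_1,…,f_l be real-valued functions on Z, and let E = { P_θ : θ ∈ ℝ^l } where P_θ(z) = P(z) exp(∑_{j=1}^l θ^j f_j(z) − φ(θ)) and φ(θ) = log ∑_{z∈Z} P(z) exp(∑_{j=1}^l θ^j f_j(z)). Let Q be a probability distribution on Z. If Q_* ∈ E satisfies ∑_{z∈Z} f_j(z) Q_*(z) = ∑_{z∈Z} f_j(z) Q(z) for every j = 1,…,l, then D(Q‖P₂) = D(Q‖Q_*) + D(Q_*‖P₂) for every P₂ ∈ E, and such an element Q_* of E is unique. -/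
open Real Finset

/-- A probability distribution on a finite type. -/
def IsDist {α : Type*} [Fintype α] (p : α → ℝ) : Prop :=
  (∀ i, 0 ≤ p i) ∧ ∑ i, p i = 1

/-- Kullback–Leibler divergence `D(p‖q) = ∑ p z log (p z / q z)` (natural log). -/
noncomputable def KL {α : Type*} [Fintype α] (p q : α → ℝ) : ℝ :=
  ∑ z, p z * Real.log (p z / q z)

/-- Member `P_θ` of the exponential family with base `P` generated by `f_1,…,f_l`:
`P_θ(z) = P(z) exp(∑_j θ^j f_j(z) − φ(θ))` with
`φ(θ) = log ∑_z P(z) exp(∑_j θ^j f_j(z))`. -/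
noncomputable def expFam {α ι : Type*} [Fintype α] [Fintype ι]
    (P : α → ℝ) (f : ι → α → ℝ) (θ : ι → ℝ) : α → ℝ :=
  fun z => P z * Real.exp (∑ j, θ j * f j z -
    Real.log (∑ w, P w * Real.exp (∑ j, θ j * f j w)))

lemma expFam_pos {α ι : Type*} [Fintype α] [Fintype ι] {P : α → ℝ} (hP : ∀ z, 0 < P z)
    (f : ι → α → ℝ) (θ : ι → ℝ) (z : α) : 0 < expFam P f θ z :=
  mul_pos (hP z) (Real.exp_pos _)

lemma sum_expFam {α ι : Type*} [Fintype α] [Nonempty α] [Fintype ι] {P : α → ℝ}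
    (hP : ∀ z, 0 < P z) (f : ι → α → ℝ) (θ : ι → ℝ) : ∑ z, expFam P f θ z = 1 := by
  have h : 0 < ∑ w, P w * Real.exp (∑ j, θ j * f j w) :=
    Finset.sum_pos (fun w _ => mul_pos (hP w) (Real.exp_pos _)) Finset.univ_nonempty
  simp only [expFam, Real.exp_sub, Real.exp_log h, ← mul_div_assoc]
  rw [← Finset.sum_div, div_self h.ne']

/-- The log-ratio of two members of an exponential family is an affine combination of the
generators. -/
lemma exists_log_expFam_sub {α ι : Type*} [Fintype α] [Fintype ι] {P : α → ℝ}
    (hP : ∀ z, 0 < P z) (f : ι → α → ℝ) (θ η : ι → ℝ) :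
    ∃ c : ℝ, ∀ z, Real.log (expFam P f θ z) - Real.log (expFam P f η z)
      = ∑ j, (θ j - η j) * f j z + c := by
  refine ⟨Real.log (∑ w, P w * Real.exp (∑ j, η j * f j w)) -
    Real.log (∑ w, P w * Real.exp (∑ j, θ j * f j w)), fun z => ?_⟩
  simp only [expFam, Real.log_mul (hP z).ne' (Real.exp_pos _).ne', Real.log_exp, sub_mul,
    Finset.sum_sub_distrib]
  ring

/-- The expectation of the log-ratio of two members of an exponential family depends only on the
total mass and the expectations of the generators. -/
lemma sum_mul_log_expFam_sub_eq {α ι : Type*} [Fintype α] [Fintype ι] {P : α → ℝ}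
    (hP : ∀ z, 0 < P z) (f : ι → α → ℝ) (θ η : ι → ℝ) {R S : α → ℝ}
    (hsum : ∑ z, R z = ∑ z, S z) (hmean : ∀ j, ∑ z, f j z * R z = ∑ z, f j z * S z) :
    ∑ z, R z * (Real.log (expFam P f θ z) - Real.log (expFam P f η z))
      = ∑ z, S z * (Real.log (expFam P f θ z) - Real.log (expFam P f η z)) := by
  obtain ⟨c, hc⟩ := exists_log_expFam_sub hP f θ η
  have key (T : α → ℝ) : ∑ z, T z * (∑ j, (θ j - η j) * f j z + c)
      = ∑ j, (θ j - η j) * ∑ z, f j z * T z + c * ∑ z, T z := by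
    simp only [mul_add, Finset.sum_add_distrib, Finset.mul_sum]
    rw [Finset.sum_comm]
    congr 1
    · exact Finset.sum_congr rfl fun j _ => Finset.sum_congr rfl fun z _ => by ring
    · exact Finset.sum_congr rfl fun z _ => mul_comm _ _
  simp only [hc, key, hsum, hmean]

lemma KL_sub_KL {α : Type*} [Fintype α] (p : α → ℝ) {q r : α → ℝ}
    (hq : ∀ z, 0 < q z) (hr : ∀ z, 0 < r z) :
    KL p r - KL p q = ∑ z, p z * (Real.log (q z) - Real.log (r z)) := by
  simp only [KL, ← Finset.sum_sub_distrib]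
  refine Finset.sum_congr rfl fun z _ => ?_
  rcases eq_or_ne (p z) 0 with h | h
  · simp [h]
  · rw [Real.log_div h (hr z).ne', Real.log_div h (hq z).ne']
    ring

lemma KL_self {α : Type*} [Fintype α] (p : α → ℝ) : KL p p = 0 :=
  Finset.sum_eq_zero fun z _ => by
    rcases eq_or_ne (p z) 0 with h | h <;> simp [h]

lemma sub_mul_log_sub_log_nonneg {x y : ℝ} (hx : 0 < x) (hy : 0 < y) :
    0 ≤ (x - y) * (Real.log x - Real.log y) := by
  rcases le_total x y with h | h
  · exact mul_nonneg_of_nonpos_of_nonpos (sub_nonpos.2 h) (sub_nonpos.2 (Real.log_le_log hx h))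
  · exact mul_nonneg (sub_nonneg.2 h) (sub_nonneg.2 (Real.log_le_log hy h))

/-- an element `Q_*` of the exponential family `E` whose expectations
of `f_1,…,f_l` match those of `Q` is the e-projection of `Q` onto `E`: the
Pythagorean identity `D(Q‖P₂) = D(Q‖Q_*) + D(Q_*‖P₂)` holds for every `P₂ ∈ E`,
and such an element of `E` is unique. -/
theorem stmt12 {Z : Type*} [Fintype Z] {l : ℕ} (P : Z → ℝ)
    (hP : ∀ z, 0 < P z) (hPsum : ∑ z, P z = 1)
    (f : Fin l → Z → ℝ) (Q : Z → ℝ) (hQ : IsDist Q)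
    (Qstar : Z → ℝ) (hQstarE : ∃ θ : Fin l → ℝ, Qstar = expFam P f θ)
    (hmatch : ∀ j, ∑ z, f j z * Qstar z = ∑ z, f j z * Q z) :
    (∀ P₂ : Z → ℝ, (∃ θ : Fin l → ℝ, P₂ = expFam P f θ) →
        KL Q P₂ = KL Q Qstar + KL Qstar P₂)
    ∧ ∀ Q' : Z → ℝ, (∃ θ : Fin l → ℝ, Q' = expFam P f θ) →
        (∀ j, ∑ z, f j z * Q' z = ∑ z, f j z * Q z) → Q' = Qstar := by
  have : Nonempty Z := by
    by_contra h
    rw [not_nonempty_iff] at h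
    simp at hPsum
  obtain ⟨θ, rfl⟩ := hQstarE
  constructor
  · rintro _ ⟨η, rfl⟩
    have hpos := expFam_pos hP f
    have h := sum_mul_log_expFam_sub_eq hP f θ η ((sum_expFam hP f θ).trans hQ.2.symm) hmatch
    rw [← KL_sub_KL _ (hpos θ) (hpos η), ← KL_sub_KL _ (hpos θ) (hpos η), KL_self] at h
    linarith
  · rintro _ ⟨η, rfl⟩ hmatch'
    have hpos := expFam_pos hP f
    have h := sum_mul_log_expFam_sub_eq hP f η θ
      ((sum_expFam hP f η).trans (sum_expFam hP f θ).symm)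
      fun j => (hmatch' j).trans (hmatch j).symm
    rw [← sub_eq_zero, ← Finset.sum_sub_distrib] at h
    simp only [← sub_mul] at h
    rw [Finset.sum_eq_zero_iff_of_nonneg fun z _ =>
      sub_mul_log_sub_log_nonneg (hpos η z) (hpos θ z)] at h
    funext z
    rcases mul_eq_zero.1 (h z (Finset.mem_univ z)) with h | h
    · exact sub_eq_zero.1 h
    · exact Real.log_injOn_pos (hpos η z) (hpos θ z) (sub_eq_zero.1 h)
end

section
/- Let ε ∈ (0, 1/2) and consider the channel with input alphabet X = {1,2,4} and output alphabet Y = {1,2,3} given by W_1 = (1−ε, 0, ε), W_2 = (0, 1−ε, ε), W_4 = (1/2−ε, 1/2−ε, 2ε). Set h₃ = h(2ε) + (1−2ε)·log 2 − h(ε). If ((1−2ε)/(2ε))·exp(−h₃/ε) ≤ 1 ≤ ((1−ε)/(2ε))·exp(−h₃/ε), then the capacity of this channel equals log(2 + exp(−h₃/ε)) + h(2ε) + (1−2ε)·log 2 − 2·h(ε). -/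
open Real Finset

/-- Shannon entropy `H(p) = -∑ p z log p z` (natural log). -/
noncomputable def Hent {α : Type*} [Fintype α] (p : α → ℝ) : ℝ :=
  -∑ z, p z * Real.log (p z)

/-- Output distribution `W·q` of a channel `W` under input distribution `q`. -/
noncomputable def output {α β : Type*} [Fintype α] [Fintype β]
    (W : α → β → ℝ) (q : α → ℝ) : β → ℝ :=
  fun y => ∑ x, q x * W x y

/-- Mutual information `∑_x q x D(W_x‖W·q)`. -/
noncomputable def mutInfo {α β : Type*} [Fintype α] [Fintype β]
    (W : α → β → ℝ) (q : α → ℝ) : ℝ :=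
  ∑ x, q x * KL (W x) (output W q)

/-- The channel capacity `C(W)`, the maximum of the mutual information over
input distributions. -/
noncomputable def capacity {α β : Type*} [Fintype α] [Fintype β]
    (W : α → β → ℝ) : ℝ :=
  sSup {c | ∃ q, IsDist q ∧ c = mutInfo W q}

/-- Binary entropy `h(t) = −t log t − (1−t) log(1−t)` (natural log). -/
noncomputable def bent (t : ℝ) : ℝ :=
  -(t * Real.log t) - (1 - t) * Real.log (1 - t)

/-- Mutual information is at most the average divergence from any positive reference
distribution. -/
theorem mutInfo_le_sum_KL {α β : Type*} [Fintype α] [Fintype β] (W : α → β → ℝ) (q : α → ℝ)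
    (r : β → ℝ) (hW : ∀ x, IsDist (W x)) (hq : IsDist q) (hr : IsDist r) (hr0 : ∀ y, 0 < r y) :
    mutInfo W q ≤ ∑ x, q x * KL (W x) r := by
  have ho : ∀ x y, q x * W x y ≤ output W q y := fun x y =>
    Finset.single_le_sum (f := fun x => q x * W x y)
      (fun i _ => mul_nonneg (hq.1 i) ((hW i).1 y)) (Finset.mem_univ x)
  have hterm : ∀ x y, q x * (W x y * Real.log (W x y / output W q y)) ≤
      q x * (W x y * Real.log (W x y / r y)) +
        (q x * W x y * (r y / output W q y) - q x * W x y) := by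
    intro x y
    rcases (hq.1 x).eq_or_lt with h | hqx
    · simp [← h]
    rcases ((hW x).1 y).eq_or_lt with h | hwx
    · simp [← h]
    have hpos : 0 < output W q y := (mul_pos hqx hwx).trans_le (ho x y)
    have hlog := Real.log_le_sub_one_of_pos (div_pos (hr0 y) hpos)
    rw [Real.log_div (hr0 y).ne' hpos.ne'] at hlog
    rw [Real.log_div hwx.ne' hpos.ne', Real.log_div hwx.ne' (hr0 y).ne']
    have := mul_le_mul_of_nonneg_left hlog (mul_pos hqx hwx).le
    linarith
  have houter : ∑ y, output W q y = 1 := by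
    unfold output
    rw [Finset.sum_comm]
    simp only [← Finset.mul_sum, (hW _).2, mul_one, hq.2]
  have hcorr : ∑ x, ∑ y, (q x * W x y * (r y / output W q y) - q x * W x y) ≤ 0 := by
    rw [Finset.sum_comm]
    simp only [Finset.sum_sub_distrib, ← Finset.sum_mul]
    change ∑ y, output W q y * (r y / output W q y) - ∑ y, output W q y ≤ 0
    rw [houter, ← hr.2, ← Finset.sum_sub_distrib]
    refine Finset.sum_nonpos fun y _ => ?_
    by_cases h : output W q y = 0
    · simp [h, (hr0 y).le]
    · rw [mul_div_cancel₀ _ h, sub_self]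
  have hsum := Finset.sum_le_sum fun x (_ : x ∈ Finset.univ) =>
    Finset.sum_le_sum fun y (_ : y ∈ Finset.univ) => hterm x y
  simp only [Finset.sum_add_distrib, ← Finset.mul_sum] at hsum
  simp only [mutInfo, KL]
  linarith

/-- If every row of a channel has divergence `C` from a positive output distribution,
the capacity is `C`. -/
theorem capacity_eq_of_KL_eq {α β : Type*} [Fintype α] [Fintype β] (W : α → β → ℝ) (q : α → ℝ)
    (C : ℝ) (hW : ∀ x, IsDist (W x)) (hq : IsDist q) (ho : IsDist (output W q))
    (ho0 : ∀ y, 0 < output W q y) (hC : ∀ x, KL (W x) (output W q) = C) :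
    capacity W = C := by
  refine IsGreatest.csSup_eq ⟨⟨q, hq, ?_⟩, ?_⟩
  · simp [mutInfo, hC, ← Finset.sum_mul, hq.2]
  · rintro _ ⟨q', hq', rfl⟩
    refine (mutInfo_le_sum_KL W q' _ hW hq' ho ho0).trans_eq ?_
    simp [hC, ← Finset.sum_mul, hq'.2]

/-- for the three-input channel `W₁ = (1−ε, 0, ε)`, `W₂ = (0, 1−ε, ε)`,
`W₄ = (1/2−ε, 1/2−ε, 2ε)` with `ε ∈ (0, 1/2)` and
`h₃ = h(2ε) + (1−2ε) log 2 − h(ε)`, if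
`((1−2ε)/(2ε)) e^{−h₃/ε} ≤ 1 ≤ ((1−ε)/(2ε)) e^{−h₃/ε}` then the capacity equals
`log(2 + e^{−h₃/ε}) + h(2ε) + (1−2ε) log 2 − 2 h(ε)`. -/
theorem stmt18 (ε : ℝ) (hε0 : 0 < ε) (hε : ε < 1 / 2)
    (h₃ : ℝ) (hh₃ : h₃ = bent (2 * ε) + (1 - 2 * ε) * Real.log 2 - bent ε)
    (hcond1 : (1 - 2 * ε) / (2 * ε) * Real.exp (-h₃ / ε) ≤ 1)
    (hcond2 : 1 ≤ (1 - ε) / (2 * ε) * Real.exp (-h₃ / ε)) :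
    capacity (![![1 - ε, 0, ε], ![0, 1 - ε, ε], ![1 / 2 - ε, 1 / 2 - ε, 2 * ε]]
        : Fin 3 → Fin 3 → ℝ)
      = Real.log (2 + Real.exp (-h₃ / ε)) + bent (2 * ε)
        + (1 - 2 * ε) * Real.log 2 - 2 * bent ε := by
  set t := Real.exp (-h₃ / ε) with ht
  have ht0 : 0 < t := Real.exp_pos _
  have ht2 : 0 < 2 + t := by linarith
  have hlogt : ε * Real.log t = -h₃ := by
    rw [ht, Real.log_exp]
    field_simp
  have h1 : (1 - 2 * ε) * t ≤ 2 * ε := by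
    rwa [div_mul_eq_mul_div, div_le_one (by linarith)] at hcond1
  have h2 : 2 * ε ≤ (1 - ε) * t := by
    rwa [div_mul_eq_mul_div, le_div_iff₀ (by linarith), one_mul] at hcond2
  set W : Fin 3 → Fin 3 → ℝ :=
    ![![1 - ε, 0, ε], ![0, 1 - ε, ε], ![1 / 2 - ε, 1 / 2 - ε, 2 * ε]] with hWdef
  set c := t / (ε * (2 + t)) - 1 with hc
  have hc0 : 0 ≤ c := by
    rw [hc, sub_nonneg, le_div_iff₀ (by positivity)]
    linarith
  have hc1 : c ≤ 1 := by
    rw [hc, sub_le_iff_le_add, div_le_iff₀ (by positivity)]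
    linarith
  have hct : ε * (1 + c) = t / (2 + t) := by
    rw [hc]
    field_simp
    ring
  have hps : 1 / (2 + t) = (1 - t / (2 + t)) / 2 := by
    field_simp
    ring
  have hout : output W ![(1 - c) / 2, (1 - c) / 2, c] =
      ![1 / (2 + t), 1 / (2 + t), t / (2 + t)] := by
    rw [hps, ← hct]
    funext y
    fin_cases y <;> simp [output, Fin.sum_univ_three, hWdef] <;> ring
  have l1 : Real.log ((1 - ε) / (1 / (2 + t))) = Real.log (1 - ε) + Real.log (2 + t) := by
    rw [div_div_eq_mul_div, div_one, Real.log_mul (by linarith) ht2.ne']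
  have l2 : Real.log (ε / (t / (2 + t))) = Real.log ε + Real.log (2 + t) - Real.log t := by
    rw [div_div_eq_mul_div, Real.log_div (by positivity) ht0.ne', Real.log_mul hε0.ne' ht2.ne']
  have l3 : Real.log ((1 / 2 - ε) / (1 / (2 + t))) =
      Real.log (1 - 2 * ε) - Real.log 2 + Real.log (2 + t) := by
    rw [div_div_eq_mul_div, div_one, Real.log_mul (by linarith) ht2.ne',
      show 1 / 2 - ε = (1 - 2 * ε) / 2 by ring, Real.log_div (by linarith) two_ne_zero]
  have l4 : Real.log (2 * ε / (t / (2 + t))) =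
      Real.log (2 * ε) + Real.log (2 + t) - Real.log t := by
    rw [div_div_eq_mul_div, Real.log_div (by positivity) ht0.ne',
      Real.log_mul (by positivity) ht2.ne']
  refine capacity_eq_of_KL_eq W ![(1 - c) / 2, (1 - c) / 2, c] _ ?_ ?_ ?_ ?_ ?_
  · intro x
    refine ⟨fun y => ?_, ?_⟩
    · fin_cases x <;> fin_cases y <;> simp [hWdef] <;> linarith
    · fin_cases x <;> simp [hWdef, Fin.sum_univ_three]; ring
  · refine ⟨fun x => ?_, ?_⟩
    · fin_cases x <;> simp <;> linarith
    · simp [Fin.sum_univ_three]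
  · rw [hout]
    refine ⟨fun y => ?_, ?_⟩
    · fin_cases y <;> simp <;> positivity
    · simp only [Fin.sum_univ_three, Matrix.cons_val]
      field_simp
      ring
  · intro y
    rw [hout]
    fin_cases y <;> simp <;> positivity
  · intro x
    rw [hout]
    fin_cases x <;>
      simp only [KL, Fin.sum_univ_three, hWdef, Matrix.cons_val, Fin.zero_eta, Fin.mk_one,
        Fin.reduceFinMk, l1, l2, l3, l4] <;>
      simp only [bent] at hh₃ ⊢
    · linear_combination hh₃ - hlogt
    · linear_combination hh₃ - hlogt
    · linear_combination 2 * hh₃ - 2 * hlogt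
end
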